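/- Let n, K, d be positive integers, let w₁,…,w_K ≥ 0 with ∑_{k=1}^K w_k = 1, let u_{ik} ∈ ℝ^d for i = 1,…,n and k = 1,…,K, and let η_{ik} ∈ ℝ satisfy η_{i1} ≥ η_{i2} ≥ ⋯ ≥ η_{iK} for each i. Define K_n = (1/n) ∑_{k=1}^K w_k ∑_{i=1}^n [φ(η_{ik})²/(Φ(η_{ik})(1 − Φ(η_{ik})))] u_{ik} u_{ik}ᵀ and V_n = (1/n) ∑_{i=1}^n ∑_{k,k'=1}^K w_k w_{k'} [φ(η_{ik}) φ(η_{ik'}) / (Φ(η_{i,min(k,k')}) · (1 − Φ(η_{i,max(k,k')})))] u_{ik} u_{ik'}ᵀ. Then K_n − V_n is positive semidefinite; in particular, λ_max(V_n) ≤ λ_max(K_n). -/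

import Mathlib

open Matrix

/-- The density `φ` of the standard normal distribution `N(0,1)`. -/
noncomputable def stdGaussPDF (t : ℝ) : ℝ := (Real.sqrt (2 * Real.pi))⁻¹ * Real.exp (-t ^ 2 / 2)

/-- The cumulative distribution function `Φ` of the standard normal distribution `N(0,1)`. -/
noncomputable def stdGaussCDF (t : ℝ) : ℝ := ∫ x in Set.Iic t, stdGaussPDF x

open ProbabilityTheory in
/-- The standard normal density is Mathlib's Gaussian density. -/
lemma stdGaussPDF_eq : stdGaussPDF = gaussianPDFReal 0 1 := by
  ext t
  simp [stdGaussPDF, gaussianPDFReal]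

lemma stdGaussPDF_pos (t : ℝ) : 0 < stdGaussPDF t := by
  rw [stdGaussPDF_eq]
  exact ProbabilityTheory.gaussianPDFReal_pos 0 1 t one_ne_zero

lemma integrable_stdGaussPDF : MeasureTheory.Integrable stdGaussPDF := by
  rw [stdGaussPDF_eq]
  exact ProbabilityTheory.integrable_gaussianPDFReal 0 1

lemma setIntegral_stdGaussPDF_pos {s : Set ℝ} (hs : 0 < MeasureTheory.volume s) :
    0 < ∫ x in s, stdGaussPDF x := by
  rw [MeasureTheory.setIntegral_pos_iff_support_of_nonneg_ae
    (Filter.Eventually.of_forall fun x => (stdGaussPDF_pos x).le)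
    integrable_stdGaussPDF.integrableOn]
  have h : Function.support stdGaussPDF = Set.univ :=
    Set.eq_univ_of_forall fun x => (stdGaussPDF_pos x).ne'
  rwa [h, Set.univ_inter]

lemma stdGaussCDF_pos (t : ℝ) : 0 < stdGaussCDF t :=
  setIntegral_stdGaussPDF_pos (by simp)

lemma stdGaussCDF_lt_one (t : ℝ) : stdGaussCDF t < 1 := by
  have h := MeasureTheory.integral_add_compl (measurableSet_Iic (a := t)) integrable_stdGaussPDF
  have h1 : ∫ x, stdGaussPDF x = 1 := by
    rw [stdGaussPDF_eq]
    exact ProbabilityTheory.integral_gaussianPDFReal_eq_one 0 one_ne_zero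
  have h2 : 0 < ∫ x in (Set.Iic t)ᶜ, stdGaussPDF x :=
    setIntegral_stdGaussPDF_pos (by simp)
  rw [h1] at h
  change stdGaussCDF t + _ = 1 at h
  linarith

lemma stdGaussCDF_mono : Monotone stdGaussCDF := fun _ _ hst =>
  MeasureTheory.setIntegral_mono_set integrable_stdGaussPDF.integrableOn
    (Filter.Eventually.of_forall fun x => (stdGaussPDF_pos x).le)
    (Set.Iic_subset_Iic.2 hst).eventuallyLE

/-- The weighted arithmetic-geometric mean inequality behind the correlation bound. -/
lemma mul_div_le_half_add_of_le {p q : ℝ} (hq : 0 < q) (hqp : q ≤ p) (hp : p < 1) (a b : ℝ) :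
    a * b / (p * (1 - q)) ≤ (a ^ 2 / (p * (1 - p)) + b ^ 2 / (q * (1 - q))) / 2 := by
  have hp0 : 0 < p := hq.trans_le hqp
  have hp1 : 0 < 1 - p := sub_pos.2 hp
  have hq1 : 0 < 1 - q := by linarith
  have key : 0 ≤ (a - b) ^ 2 / (p * (1 - q)) := by positivity
  have ha : a ^ 2 / (p * (1 - q)) ≤ a ^ 2 / (p * (1 - p)) := by gcongr
  have hb : b ^ 2 / (p * (1 - q)) ≤ b ^ 2 / (q * (1 - q)) := by gcongr
  have e : (a - b) ^ 2 / (p * (1 - q)) =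
      a ^ 2 / (p * (1 - q)) + b ^ 2 / (p * (1 - q)) - 2 * (a * b / (p * (1 - q))) := by ring
  linarith

/-- If `c k k'` is bounded by the mean of `g k` and `g k'`, then so is its weighted double sum. -/
lemma sum_sum_weighted_le {K : ℕ} {w g : Fin K → ℝ} {c : Fin K → Fin K → ℝ}
    (hw : ∀ k, 0 ≤ w k) (hw1 : ∑ k, w k = 1) (hc : ∀ k k', c k k' ≤ (g k + g k') / 2) :
    ∑ k, ∑ k', w k * w k' * c k k' ≤ ∑ k, w k * g k := by
  calc ∑ k, ∑ k', w k * w k' * c k k'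
      ≤ ∑ k, ∑ k', w k * w k' * ((g k + g k') / 2) :=
        Finset.sum_le_sum fun k _ => Finset.sum_le_sum fun k' _ =>
          mul_le_mul_of_nonneg_left (hc k k') (mul_nonneg (hw k) (hw k'))
    _ = ((∑ k, w k * g k) * (∑ k', w k') + (∑ k, w k) * ∑ k', w k' * g k') / 2 := by
        rw [Finset.sum_mul_sum, Finset.sum_mul_sum, ← Finset.sum_add_distrib, Finset.sum_div]
        refine Finset.sum_congr rfl fun k _ => ?_
        rw [← Finset.sum_add_distrib, Finset.sum_div]
        exact Finset.sum_congr rfl fun k' _ => by ring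
    _ = ∑ k, w k * g k := by rw [hw1]; ring

lemma dotProduct_vecMulVec_mulVec {d : ℕ} (a b x : Fin d → ℝ) :
    x ⬝ᵥ (vecMulVec a b *ᵥ x) = (a ⬝ᵥ x) * (b ⬝ᵥ x) := by
  rw [vecMulVec_mulVec, dotProduct_smul, dotProduct_comm x a]
  simp

open scoped MatrixOrder in
/-- The largest eigenvalue is monotone in the Loewner order. -/
lemma iSup_eigenvalues_le_of_posSemidef_sub {d : ℕ} (hd : 0 < d) {A B : Matrix (Fin d) (Fin d) ℝ}
    (h : (B - A).PosSemidef) (hB : B.IsHermitian) (hA : A.IsHermitian) :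
    (⨆ j, hA.eigenvalues j) ≤ ⨆ j, hB.eigenvalues j := by
  have : Nonempty (Fin d) := ⟨⟨0, hd⟩⟩
  have h1 : A ≤ B := Matrix.le_iff.2 h
  have h2 : B ≤ algebraMap ℝ _ (⨆ j, hB.eigenvalues j) := by
    refine le_algebraMap_of_spectrum_le (fun r hr => ?_) hB.isSelfAdjoint
    rw [hB.spectrum_real_eq_range_eigenvalues] at hr
    obtain ⟨j, rfl⟩ := hr
    exact le_ciSup (Set.finite_range _).bddAbove j
  exact ciSup_le fun j => (le_algebraMap_iff_spectrum_le hA.isSelfAdjoint).1 (h1.trans h2) _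
    (hA.eigenvalues_mem_spectrum_real j)

/-- The sensitivity matrix `K_n` dominates the variability matrix `V_n` of the composite
probit score: with weights `w_k ≥ 0` summing to 1 and linear predictors `η_{i1} ≥ ⋯ ≥ η_{iK}`,
the matrix `K_n − V_n` is positive semidefinite; in particular `λ_max(V_n) ≤ λ_max(K_n)`. -/
theorem sensitivity_dominates_variability
    (n K d : ℕ) (hn : 0 < n) (hK : 0 < K) (hd : 0 < d)
    (w : Fin K → ℝ) (hw : ∀ k, 0 ≤ w k) (hw1 : ∑ k, w k = 1)
    (u : Fin n → Fin K → Fin d → ℝ) (η : Fin n → Fin K → ℝ)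
    (hη : ∀ i, Antitone (η i)) :
    letI Kn : Matrix (Fin d) (Fin d) ℝ :=
      (1 / (n : ℝ)) • ∑ k, w k • ∑ i,
        (stdGaussPDF (η i k) ^ 2 / (stdGaussCDF (η i k) * (1 - stdGaussCDF (η i k)))) •
          vecMulVec (u i k) (u i k)
    letI Vn : Matrix (Fin d) (Fin d) ℝ :=
      (1 / (n : ℝ)) • ∑ i, ∑ k, ∑ k',
        (w k * w k' * (stdGaussPDF (η i k) * stdGaussPDF (η i k') /
            (stdGaussCDF (η i (min k k')) * (1 - stdGaussCDF (η i (max k k')))))) •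
          vecMulVec (u i k) (u i k')
    (Kn - Vn).PosSemidef ∧
      ∀ (hKh : Kn.IsHermitian) (hVh : Vn.IsHermitian),
        (⨆ j, hVh.eigenvalues j) ≤ ⨆ j, hKh.eigenvalues j := by
  have hpsd : ((1 / (n : ℝ)) • ∑ k, w k • ∑ i,
        (stdGaussPDF (η i k) ^ 2 / (stdGaussCDF (η i k) * (1 - stdGaussCDF (η i k)))) •
          vecMulVec (u i k) (u i k) -
      (1 / (n : ℝ)) • ∑ i, ∑ k, ∑ k',
        (w k * w k' * (stdGaussPDF (η i k) * stdGaussPDF (η i k') /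
            (stdGaussCDF (η i (min k k')) * (1 - stdGaussCDF (η i (max k k')))))) •
          vecMulVec (u i k) (u i k')).PosSemidef := by
    refine PosSemidef.of_dotProduct_mulVec_nonneg (IsHermitian.sub ?_ ?_) fun x => ?_
    · ext a b
      simp only [conjTranspose_apply, star_trivial, Matrix.smul_apply, Matrix.sum_apply,
        vecMulVec_apply,
        mul_comm (u _ _ b) (u _ _ a)]
    · ext a b
      simp only [conjTranspose_apply, star_trivial, Matrix.smul_apply, Matrix.sum_apply,
        vecMulVec_apply,
        smul_eq_mul]
      congr 1
      refine Finset.sum_congr rfl fun i _ => ?_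
      rw [Finset.sum_comm]
      refine Finset.sum_congr rfl fun k _ => Finset.sum_congr rfl fun k' _ => ?_
      rw [min_comm, max_comm]
      ring
    · rw [star_trivial, ← smul_sub, smul_mulVec, dotProduct_smul, smul_eq_mul]
      refine mul_nonneg (by positivity) ?_
      simp only [sub_mulVec, dotProduct_sub, sum_mulVec, dotProduct_sum, smul_mulVec,
        dotProduct_smul, dotProduct_vecMulVec_mulVec, smul_eq_mul, Finset.mul_sum]
      rw [sub_nonneg, Finset.sum_comm (s := Finset.univ (α := Fin K))]
      refine Finset.sum_le_sum fun i _ => ?_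
      have mean_bound : ∀ k k', k ≤ k' → ∀ a b : ℝ,
          a * b / (stdGaussCDF (η i k) * (1 - stdGaussCDF (η i k'))) ≤
            (a ^ 2 / (stdGaussCDF (η i k) * (1 - stdGaussCDF (η i k))) +
              b ^ 2 / (stdGaussCDF (η i k') * (1 - stdGaussCDF (η i k')))) / 2 :=
        fun k k' hk => mul_div_le_half_add_of_le (stdGaussCDF_pos _)
          (stdGaussCDF_mono (hη i hk)) (stdGaussCDF_lt_one _)
      let y : Fin K → ℝ := fun k => stdGaussPDF (η i k) * (u i k ⬝ᵥ x)
      refine le_trans (le_of_eq ?_) ((sum_sum_weighted_le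
        (g := fun k => y k ^ 2 / (stdGaussCDF (η i k) * (1 - stdGaussCDF (η i k))))
        (c := fun k k' => y k * y k' /
          (stdGaussCDF (η i (min k k')) * (1 - stdGaussCDF (η i (max k k')))))
        hw hw1 fun k k' => ?_).trans (le_of_eq ?_))
      · exact Finset.sum_congr rfl fun k _ => Finset.sum_congr rfl fun k' _ => by
          simp only [y]; ring
      · rcases le_total k k' with hk | hk
        · rw [min_eq_left hk, max_eq_right hk]
          exact mean_bound k k' hk _ _
        · rw [min_eq_right hk, max_eq_left hk, mul_comm (y k), add_comm]
          exact mean_bound k' k hk _ _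
      · exact Finset.sum_congr rfl fun k _ => by simp only [y]; ring
  exact ⟨hpsd, iSup_eigenvalues_le_of_posSemidef_sub hd hpsd⟩
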